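/- arXiv:2510.17091 — 2 statements merged into one kernel-verified Lean document; each statement's English description precedes it below -/
import Mathlib

section
/- Fix an integer n ≥ 1. There exists a constant D ≥ 1 depending only on n such that for every box B = ∏_{i=1}^n (−a_i, a_i) ⊆ ℝⁿ, every point x in the closure of B, and every r > 0, one has ∫_{B ∩ B(x,2r)} φ_B(y)² dy ≤ D · ∫_{B ∩ B(x,r)} φ_B(y)² dy, where B(x,r) denotes the Euclidean ball of center x and radius r and φ_B(y) = ∏_{i=1}^n a_i^{−1/2} cos(π y_i/(2 a_i)). -/
open Real MeasureTheory

/-- The open box `∏ i (-a i, a i)` in `ℝⁿ`. -/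
def box (n : ℕ) (a : Fin n → ℝ) : Set (EuclideanSpace ℝ (Fin n)) := {x | ∀ i, |x i| < a i}

/-- The principal Dirichlet eigenfunction of the box `∏ i (-a i, a i)`. -/
noncomputable def boxEigenfunction (n : ℕ) (a : Fin n → ℝ)
    (x : EuclideanSpace ℝ (Fin n)) : ℝ :=
  ∏ i, (1 / Real.sqrt (a i)) * Real.cos (π * x i / (2 * a i))

theorem isOpen_box (n : ℕ) (a : Fin n → ℝ) : IsOpen (box n a) := by
  simp only [box, Set.ofPred_forall]
  exact isOpen_iInter_of_finite fun i => isOpen_lt (by fun_prop) continuous_const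

theorem abs_le_of_mem_closure_box {n : ℕ} {a : Fin n → ℝ} {x : EuclideanSpace ℝ (Fin n)}
    (hx : x ∈ closure (box n a)) (i : Fin n) : |x i| ≤ a i := by
  have hclosed : IsClosed {y : EuclideanSpace ℝ (Fin n) | |y i| ≤ a i} :=
    isClosed_le (by fun_prop) continuous_const
  exact closure_minimal (fun y hy => (hy i).le) hclosed hx

theorem continuous_boxEigenfunction (n : ℕ) (a : Fin n → ℝ) :
    Continuous (boxEigenfunction n a) := by
  unfold boxEigenfunction
  fun_prop

/-- The midpoint of a point of the closed box and a point of the open box is in the open box. -/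
theorem midpoint_mem_box {n : ℕ} {a : Fin n → ℝ} {x y : EuclideanSpace ℝ (Fin n)}
    (hx : x ∈ closure (box n a)) (hy : y ∈ box n a) :
    (1 / 2 : ℝ) • y + (1 / 2 : ℝ) • x ∈ box n a := by
  intro i
  have h1 := abs_le.1 (abs_le_of_mem_closure_box hx i)
  have h2 := abs_lt.1 (hy i)
  simp only [PiLp.add_apply, PiLp.smul_apply, smul_eq_mul]
  rw [abs_lt]
  constructor <;> linarith [h1.1, h1.2, h2.1, h2.2]

theorem cos_nonneg_of_abs_le {a t : ℝ} (ha : 0 < a) (ht : |t| ≤ a) :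
    0 ≤ Real.cos (π * t / (2 * a)) := by
  have h := abs_le.1 ht
  apply Real.cos_nonneg_of_neg_pi_div_two_le_of_le
  · rw [le_div_iff₀ (by positivity)]
    nlinarith [Real.pi_pos, h.1]
  · rw [div_le_iff₀ (by positivity)]
    nlinarith [Real.pi_pos, h.2]

/-- Concavity of the cosine between its zeros, in the form of a midpoint lower bound. -/
theorem cos_le_two_mul_cos_midpoint {a s t : ℝ} (ha : 0 < a) (hs : |s| ≤ a) (ht : |t| ≤ a) :
    Real.cos (π * t / (2 * a)) ≤
      2 * Real.cos (π * (1 / 2 * t + 1 / 2 * s) / (2 * a)) := by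
  have hmid : |1 / 2 * t + 1 / 2 * s| ≤ a := by
    have h1 := abs_le.1 hs
    have h2 := abs_le.1 ht
    rw [abs_le]
    constructor <;> linarith [h1.1, h1.2, h2.1, h2.2]
  have hsum : Real.cos (π * t / (2 * a)) + Real.cos (π * s / (2 * a)) =
      2 * Real.cos (π * (1 / 2 * t + 1 / 2 * s) / (2 * a)) *
        Real.cos ((π * t / (2 * a) - π * s / (2 * a)) / 2) := by
    rw [Real.cos_add_cos]
    congr 3
    ring
  nlinarith [cos_nonneg_of_abs_le ha hs, cos_nonneg_of_abs_le ha hmid,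
    Real.cos_le_one ((π * t / (2 * a) - π * s / (2 * a)) / 2)]

theorem boxEigenfunction_sq_le {n : ℕ} {a : Fin n → ℝ} (ha : ∀ i, 0 < a i)
    {x y : EuclideanSpace ℝ (Fin n)} (hx : x ∈ closure (box n a)) (hy : y ∈ box n a) :
    boxEigenfunction n a y ^ 2 ≤
      4 ^ n * boxEigenfunction n a ((1 / 2 : ℝ) • y + (1 / 2 : ℝ) • x) ^ 2 := by
  have hnonneg : 0 ≤ boxEigenfunction n a y :=
    Finset.prod_nonneg fun i _ =>
      mul_nonneg (by positivity) (cos_nonneg_of_abs_le (ha i) (hy i).le)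
  have hle : boxEigenfunction n a y ≤
      2 ^ n * boxEigenfunction n a ((1 / 2 : ℝ) • y + (1 / 2 : ℝ) • x) := by
    have hpow : (2 : ℝ) ^ n = ∏ _i : Fin n, (2 : ℝ) := by simp
    rw [boxEigenfunction, boxEigenfunction, hpow, ← Finset.prod_mul_distrib]
    refine Finset.prod_le_prod (fun i _ =>
      mul_nonneg (by positivity) (cos_nonneg_of_abs_le (ha i) (hy i).le)) fun i _ => ?_
    rw [mul_left_comm]
    exact mul_le_mul_of_nonneg_left
      (cos_le_two_mul_cos_midpoint (ha i) (abs_le_of_mem_closure_box hx i) (hy i).le)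
      (by positivity)
  calc boxEigenfunction n a y ^ 2
      ≤ (2 ^ n * boxEigenfunction n a ((1 / 2 : ℝ) • y + (1 / 2 : ℝ) • x)) ^ 2 :=
        pow_le_pow_left₀ hnonneg hle 2
    _ = _ := by
        rw [mul_pow, ← pow_mul, mul_comm n 2, pow_mul]
        norm_num

theorem stmt_12 (n : ℕ) (hn : 1 ≤ n) :
    ∃ D ≥ (1 : ℝ), ∀ a : Fin n → ℝ, (∀ i, 0 < a i) →
      ∀ x ∈ closure (box n a), ∀ r : ℝ, 0 < r →
        (∫ y in box n a ∩ Metric.ball x (2 * r), (boxEigenfunction n a y) ^ 2) ≤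
          D * ∫ y in box n a ∩ Metric.ball x r, (boxEigenfunction n a y) ^ 2 := by
  refine ⟨8 ^ n, one_le_pow₀ (by norm_num), fun a ha x hx r hr => ?_⟩
  have hS : MeasurableSet (box n a ∩ Metric.ball x (2 * r)) :=
    ((isOpen_box n a).inter Metric.isOpen_ball).measurableSet
  have hT : MeasurableSet (box n a ∩ Metric.ball x r) :=
    ((isOpen_box n a).inter Metric.isOpen_ball).measurableSet
  set g : EuclideanSpace ℝ (Fin n) → ℝ :=
    (box n a ∩ Metric.ball x r).indicator fun y => boxEigenfunction n a y ^ 2 with hg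
  have hg_nonneg : ∀ y, 0 ≤ g y := Set.indicator_nonneg fun y _ => sq_nonneg _
  have hg_int : Integrable g := by
    rw [hg, integrable_indicator_iff hT]
    exact (((continuous_boxEigenfunction n a).pow 2).continuousOn.integrableOn_compact
      (isCompact_closedBall x r)).mono_set
        (Set.inter_subset_right.trans Metric.ball_subset_closedBall)
  have hcomp_int : Integrable fun y => g ((1 / 2 : ℝ) • y + (1 / 2 : ℝ) • x) :=
    (hg_int.comp_add_right ((1 / 2 : ℝ) • x)).comp_smul (by norm_num : (1 / 2 : ℝ) ≠ 0)
  have hcomp : ∫ y, g ((1 / 2 : ℝ) • y + (1 / 2 : ℝ) • x) = 2 ^ n * ∫ y, g y := by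
    rw [Measure.integral_comp_smul volume (fun z => g (z + (1 / 2 : ℝ) • x)) (1 / 2 : ℝ),
      integral_add_right_eq_self g]
    simp
  have hpointwise : ∀ y, (box n a ∩ Metric.ball x (2 * r)).indicator
      (fun y => boxEigenfunction n a y ^ 2) y ≤
        4 ^ n * g ((1 / 2 : ℝ) • y + (1 / 2 : ℝ) • x) := by
    intro y
    by_cases hy : y ∈ box n a ∩ Metric.ball x (2 * r)
    · have hmem : (1 / 2 : ℝ) • y + (1 / 2 : ℝ) • x ∈ box n a ∩ Metric.ball x r := by
        refine ⟨midpoint_mem_box hx hy.1, ?_⟩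
        have hdist := hy.2
        rw [Metric.mem_ball, dist_eq_norm] at hdist ⊢
        have hsub : (1 / 2 : ℝ) • y + (1 / 2 : ℝ) • x - x = (1 / 2 : ℝ) • (y - x) := by
          module
        rw [hsub, norm_smul, Real.norm_of_nonneg (by norm_num)]
        linarith
      rw [hg, Set.indicator_of_mem hy, Set.indicator_of_mem hmem]
      exact boxEigenfunction_sq_le ha hx hy.1
    · rw [Set.indicator_of_notMem hy]
      exact mul_nonneg (by positivity) (hg_nonneg _)
  rw [← integral_indicator hS, ← integral_indicator hT]
  calc ∫ y, (box n a ∩ Metric.ball x (2 * r)).indicator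
        (fun y => boxEigenfunction n a y ^ 2) y
      ≤ ∫ y, 4 ^ n * g ((1 / 2 : ℝ) • y + (1 / 2 : ℝ) • x) :=
        integral_mono_of_nonneg
          (.of_forall (Set.indicator_nonneg fun y _ => sq_nonneg _))
          (hcomp_int.const_mul _) (.of_forall hpointwise)
    _ = 8 ^ n * ∫ y, g y := by
        rw [integral_const_mul, hcomp, ← mul_assoc, ← mul_pow]
        norm_num
end

section
/- Fix an integer n ≥ 1. There exist constants C ≥ 1 and c > 0 depending only on n such that for every box B = ∏_{i=1}^n (−a_i, a_i) ⊆ ℝⁿ the following holds, where p_B(t,x,y) := ∏_{i=1}^n p_{a_i}(t, x_i, y_i) is the Dirichlet heat kernel of B, λ_B = Σ_{i=1}^n (π/(2a_i))², and φ_B(x) = ∏_{i=1}^n a_i^{−1/2} cos(π x_i/(2 a_i)). For all t > 0 and all x, y ∈ B: e^{λ_B t}·p_B(t,x,y)/(φ_B(x)·φ_B(y)) ≤ C·∏_{i=1}^n ( 1 + (a_i/√t)³ ). Moreover, if t ≥ a_i² for every i = 1,…,n, then c·∏_{i=1}^n ( 1 − (a_i/√t)³ ) ≤ e^{λ_B t}·p_B(t,x,y)/(φ_B(x)·φ_B(y)).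 -/
open Real MeasureTheory

/-- The Dirichlet heat kernel of the interval `(-a, a)`. -/
noncomputable def intervalHeatKernel (a t x y : ℝ) : ℝ :=
  ∑' j : ℕ, Real.exp (-((((j : ℝ) + 1) * π / (2 * a)) ^ 2) * t) *
    ((1 / a) * Real.sin (((j : ℝ) + 1) * π * (x + a) / (2 * a)) *
      Real.sin (((j : ℝ) + 1) * π * (y + a) / (2 * a)))

theorem abs_sin_nat_mul_le (k : ℕ) (u : ℝ) : |sin (k * u)| ≤ k * |sin u| := by
  induction k with
  | zero => simp
  | succ k ih =>
    have h : sin (((k + 1 : ℕ) : ℝ) * u) = sin (k * u) * cos u + cos (k * u) * sin u := by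
      rw [← sin_add]; push_cast; ring_nf
    rw [h]
    calc |sin (k * u) * cos u + cos (k * u) * sin u|
        ≤ |sin (k * u)| * |cos u| + |cos (k * u)| * |sin u| := by
          rw [← abs_mul, ← abs_mul]; exact abs_add_le _ _
      _ ≤ |sin (k * u)| * 1 + 1 * |sin u| := by
          gcongr
          · exact abs_cos_le_one u
          · exact abs_cos_le_one _
      _ ≤ ((k + 1 : ℕ) : ℝ) * |sin u| := by push_cast; linarith

theorem abs_tsum_sub_zero_le {f g : ℕ → ℝ} {M : ℝ} (hg : HasSum g M)
    (hfg : ∀ j, |f (j + 1)| ≤ g j) : |∑' j, f j - f 0| ≤ M := by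
  have hs : Summable f :=
    (summable_nat_add_iff 1).1 (Summable.of_norm_bounded hg.summable hfg)
  rw [hs.tsum_eq_zero_add, add_sub_cancel_left]
  exact tsum_of_norm_bounded (f := fun j => f (j + 1)) hg hfg

/-- The `j`-th term of the series for the heat kernel of an interval divided by its ground-state
part, in the rescaled time `s` and the rescaled positions `u, v ∈ (0, π)`. -/
noncomputable def heatRatioTerm (s u v : ℝ) (j : ℕ) : ℝ :=
  exp (-((((j : ℝ) + 1) ^ 2 - 1) * s)) *
    (sin (((j : ℝ) + 1) * u) / sin u * (sin (((j : ℝ) + 1) * v) / sin v))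

theorem abs_heatRatioTerm_le (s : ℝ) {u v : ℝ} (hu : 0 < sin u) (hv : 0 < sin v) (j : ℕ) :
    |heatRatioTerm s u v j| ≤ ((j : ℝ) + 1) ^ 2 * exp (-((((j : ℝ) + 1) ^ 2 - 1) * s)) := by
  have key : ∀ w, 0 < sin w → |sin (((j : ℝ) + 1) * w) / sin w| ≤ (j : ℝ) + 1 := by
    intro w hw
    rw [abs_div, abs_of_pos hw, div_le_iff₀ hw]
    have := abs_sin_nat_mul_le (j + 1) w
    rw [abs_of_pos hw] at this
    exact_mod_cast this
  rw [heatRatioTerm, abs_mul, abs_of_pos (exp_pos _), abs_mul, mul_comm]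
  gcongr
  rw [pow_two]
  exact mul_le_mul (key u hu) (key v hv) (abs_nonneg _) (by positivity)

theorem heatRatioTerm_zero (s : ℝ) {u v : ℝ} (hu : 0 < sin u) (hv : 0 < sin v) :
    heatRatioTerm s u v 0 = 1 := by
  simp [heatRatioTerm, hu.ne', hv.ne']

theorem sq_mul_exp_le (w : ℝ) : w ^ 2 * exp (-(3 / 4 * w ^ 2)) ≤ 8 * exp (-w) := by
  have h1 : w ^ 2 ≤ 4 * exp (w ^ 2 / 4) := by linarith [add_one_le_exp (w ^ 2 / 4)]
  have h2 : exp (1 / 2 : ℝ) ≤ 2 := by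
    have h : exp (1 / 2 : ℝ) * exp (1 / 2) = exp 1 := by rw [← exp_add]; norm_num
    nlinarith [exp_one_lt_d9, exp_pos (1 / 2 : ℝ)]
  calc w ^ 2 * exp (-(3 / 4 * w ^ 2))
      ≤ 4 * exp (w ^ 2 / 4) * exp (-(3 / 4 * w ^ 2)) := by gcongr
    _ = 4 * exp (-(w ^ 2 / 2)) := by rw [mul_assoc, ← exp_add]; ring_nf
    _ ≤ 4 * exp (1 / 2 + -w) := by
        gcongr
        nlinarith [sq_nonneg (w - 1)]
    _ ≤ 8 * exp (-w) := by
        rw [exp_add]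
        nlinarith [exp_pos (-w)]

theorem abs_heatRatio_sub_one_le {r u v : ℝ} (hr : 0 < r) (hu : 0 < sin u) (hv : 0 < sin v) :
    |∑' j, heatRatioTerm (r ^ 2) u v j - 1| ≤ 8 / r ^ 3 := by
  have hq : exp (-r) < 1 := by simpa using hr
  have hg := (hasSum_geometric_of_lt_one (exp_pos (-r)).le hq).mul_left
    (8 / r ^ 2 * exp (-r))
  have h := abs_tsum_sub_zero_le (f := heatRatioTerm (r ^ 2) u v) hg ?_
  · rw [heatRatioTerm_zero _ hu hv] at h
    refine h.trans ?_
    have h1 : exp (-r) * (1 + r) ≤ 1 := by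
      calc exp (-r) * (1 + r) ≤ exp (-r) * exp r := by
            gcongr; linarith [add_one_le_exp r]
        _ = 1 := by rw [← exp_add]; simp
    rw [← div_eq_mul_inv, div_le_div_iff₀ (by linarith) (by positivity)]
    have h2 : 8 / r ^ 2 * exp (-r) * r ^ 3 = 8 * (exp (-r) * r) := by field_simp
    rw [h2]
    linarith
  · intro j
    refine (abs_heatRatioTerm_le _ hu hv _).trans ?_
    set k : ℝ := ((j + 1 : ℕ) : ℝ) + 1 with hk
    have hk2 : 2 ≤ k := by rw [hk]; push_cast; linarith [(Nat.cast_nonneg j : (0 : ℝ) ≤ j)]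
    calc k ^ 2 * exp (-((k ^ 2 - 1) * r ^ 2))
        ≤ k ^ 2 * exp (-(3 / 4 * (k * r) ^ 2)) := by
          gcongr k ^ 2 * exp (-?_)
          nlinarith [mul_nonneg (sq_nonneg r) (by nlinarith : 0 ≤ k ^ 2 - 4)]
      _ = (k * r) ^ 2 * exp (-(3 / 4 * (k * r) ^ 2)) / r ^ 2 := by field_simp
      _ ≤ 8 * exp (-(k * r)) / r ^ 2 := by gcongr ?_ / r ^ 2; exact sq_mul_exp_le _
      _ ≤ 8 * exp (((j + 1 : ℕ) : ℝ) * -r) / r ^ 2 := by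
          gcongr 8 * exp ?_ / r ^ 2; rw [hk]; linarith
      _ = 8 / r ^ 2 * exp (-r) * exp (-r) ^ j := by
          rw [exp_nat_mul, pow_succ]; ring

theorem abs_heatRatio_sub_one_le_half {s u v : ℝ} (hs : 2 ≤ s) (hu : 0 < sin u)
    (hv : 0 < sin v) : |∑' j, heatRatioTerm s u v j - 1| ≤ 1 / 2 := by
  have hg := (hasSum_geometric_of_lt_one (by norm_num : (0 : ℝ) ≤ 1 / 2) (by norm_num)).mul_left
    (1 / 16)
  have h := abs_tsum_sub_zero_le (f := heatRatioTerm s u v) hg ?_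
  · rw [heatRatioTerm_zero _ hu hv] at h
    exact h.trans (by norm_num)
  · intro j
    refine (abs_heatRatioTerm_le _ hu hv _).trans ?_
    have hj : (0 : ℝ) ≤ j := Nat.cast_nonneg j
    have he : exp (-1 : ℝ) ≤ 1 / 2 := by
      rw [exp_neg, one_div]
      gcongr
      linarith [add_one_le_exp (1 : ℝ)]
    push_cast
    calc ((j : ℝ) + 1 + 1) ^ 2 * exp (-((((j : ℝ) + 1 + 1) ^ 2 - 1) * s))
        ≤ (2 * exp j) ^ 2 * exp (((6 + 3 * j : ℕ) : ℝ) * -1 + -(2 * j)) := by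
          gcongr
          · linarith [add_one_le_exp (j : ℝ)]
          · push_cast
            nlinarith [mul_nonneg (by nlinarith : (0 : ℝ) ≤ (j + 1 + 1) ^ 2 - 1)
              (sub_nonneg.2 hs)]
      _ = 4 * (exp (-1)) ^ (6 + 3 * j) := by
          rw [exp_add, exp_nat_mul, mul_pow, ← exp_nat_mul, exp_neg (2 * (j : ℝ))]
          push_cast
          field_simp
          norm_num
      _ ≤ 4 * (1 / 2) ^ (6 + 3 * j) := by gcongr
      _ ≤ 4 * (1 / 2) ^ (6 + j) := by
          gcongr 4 * ?_
          exact pow_le_pow_of_le_one (by norm_num) (by norm_num) (by omega)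
      _ = 1 / 16 * (1 / 2) ^ j := by rw [pow_add]; norm_num; ring

theorem exp_mul_intervalHeatKernel_div {a x y : ℝ} (t : ℝ) (ha : 0 < a) :
    exp ((π / (2 * a)) ^ 2 * t) * intervalHeatKernel a t x y /
        ((1 / √a * cos (π * x / (2 * a))) * (1 / √a * cos (π * y / (2 * a)))) =
      ∑' j, heatRatioTerm ((π / (2 * a)) ^ 2 * t) (π * (x + a) / (2 * a))
        (π * (y + a) / (2 * a)) j := by
  have hcos : ∀ z, cos (π * z / (2 * a)) = sin (π * (z + a) / (2 * a)) := by
    intro z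
    rw [← sin_add_pi_div_two]
    congr 1
    field_simp
  rw [intervalHeatKernel, ← tsum_mul_left, ← tsum_div_const, hcos, hcos]
  refine tsum_congr fun j => ?_
  have hE : exp (-((((j : ℝ) + 1) ^ 2 - 1) * ((π / (2 * a)) ^ 2 * t))) =
      exp ((π / (2 * a)) ^ 2 * t) * exp (-((((j : ℝ) + 1) * π / (2 * a)) ^ 2) * t) := by
    rw [← exp_add]; ring_nf
  rw [heatRatioTerm, hE, mul_div_assoc' ((j : ℝ) + 1), mul_div_assoc' ((j : ℝ) + 1),
    ← mul_assoc ((j : ℝ) + 1), ← mul_assoc ((j : ℝ) + 1)]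
  generalize sin (π * (x + a) / (2 * a)) = p
  generalize sin (π * (y + a) / (2 * a)) = q
  have hden : 1 / √a * p * (1 / √a * q) = p * q / a := by
    field_simp
    rw [sq_sqrt ha.le]
    ring
  rw [hden]
  field_simp

theorem sin_rescaled_pos {a x : ℝ} (hx : |x| < a) : 0 < sin (π * (x + a) / (2 * a)) := by
  obtain ⟨h1, h2⟩ := abs_lt.1 hx
  have ha : 0 < a := by linarith
  apply sin_pos_of_pos_of_lt_pi
  · have : 0 < x + a := by linarith
    positivity
  · rw [div_lt_iff₀ (by positivity)]
    exact mul_lt_mul_of_pos_left (by linarith) pi_pos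

theorem abs_interval_ratio_le {a t x y : ℝ} (ht : 0 < t) (hx : |x| < a) (hy : |y| < a) :
    |exp ((π / (2 * a)) ^ 2 * t) * intervalHeatKernel a t x y /
        ((1 / √a * cos (π * x / (2 * a))) * (1 / √a * cos (π * y / (2 * a))))| ≤
      8 * (1 + (a / √t) ^ 3) := by
  have ha : 0 < a := (abs_nonneg x).trans_lt hx
  have hst : 0 < √t := sqrt_pos.2 ht
  have h := abs_heatRatio_sub_one_le (r := π / (2 * a) * √t) (by positivity)
    (sin_rescaled_pos hx) (sin_rescaled_pos hy)
  rw [mul_pow, sq_sqrt ht.le] at h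
  rw [exp_mul_intervalHeatKernel_div t ha]
  have hr : 8 / (π / (2 * a) * √t) ^ 3 ≤ 8 * (a / √t) ^ 3 := by
    calc 8 / (π / (2 * a) * √t) ^ 3 = 8 * ((2 / π) * (a / √t)) ^ 3 := by field_simp
      _ ≤ 8 * (1 * (a / √t)) ^ 3 := by
          gcongr
          rw [div_le_one pi_pos]
          exact two_le_pi
      _ = 8 * (a / √t) ^ 3 := by rw [one_mul]
  rw [abs_le] at h ⊢
  have : 0 ≤ (a / √t) ^ 3 := by positivity
  constructor <;> linarith

theorem half_le_interval_ratio {a t x y : ℝ} (hat : a ^ 2 ≤ t) (hx : |x| < a)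
    (hy : |y| < a) :
    1 / 2 ≤ exp ((π / (2 * a)) ^ 2 * t) * intervalHeatKernel a t x y /
        ((1 / √a * cos (π * x / (2 * a))) * (1 / √a * cos (π * y / (2 * a)))) := by
  have ha : 0 < a := (abs_nonneg x).trans_lt hx
  have hs : 2 ≤ (π / (2 * a)) ^ 2 * t := by
    calc (2 : ℝ) ≤ π ^ 2 / 4 := by nlinarith [pi_gt_three]
      _ = (π / (2 * a)) ^ 2 * a ^ 2 := by field_simp; norm_num
      _ ≤ (π / (2 * a)) ^ 2 * t := by gcongr
  have h := abs_heatRatio_sub_one_le_half hs (sin_rescaled_pos hx) (sin_rescaled_pos hy)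
  rw [exp_mul_intervalHeatKernel_div t ha]
  linarith [(abs_le.1 h).1]

theorem stmt_14 (n : ℕ) (hn : 1 ≤ n) :
    ∃ C ≥ (1 : ℝ), ∃ c > (0 : ℝ), ∀ a : Fin n → ℝ, (∀ i, 0 < a i) →
      ∀ t : ℝ, 0 < t → ∀ x ∈ box n a, ∀ y ∈ box n a,
        (Real.exp ((∑ i, (π / (2 * a i)) ^ 2) * t) *
              (∏ i, intervalHeatKernel (a i) t (x i) (y i)) /
              (boxEigenfunction n a x * boxEigenfunction n a y) ≤
            C * ∏ i, (1 + (a i / Real.sqrt t) ^ 3)) ∧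
        ((∀ i, (a i) ^ 2 ≤ t) →
          c * ∏ i, (1 - (a i / Real.sqrt t) ^ 3) ≤
            Real.exp ((∑ i, (π / (2 * a i)) ^ 2) * t) *
              (∏ i, intervalHeatKernel (a i) t (x i) (y i)) /
              (boxEigenfunction n a x * boxEigenfunction n a y)) := by
  refine ⟨8 ^ n, one_le_pow₀ (by norm_num), (1 / 2) ^ n, by positivity, ?_⟩
  intro a ha t ht x hx y hy
  have hratio : Real.exp ((∑ i, (π / (2 * a i)) ^ 2) * t) *
      (∏ i, intervalHeatKernel (a i) t (x i) (y i)) /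
      (boxEigenfunction n a x * boxEigenfunction n a y) =
      ∏ i, (exp ((π / (2 * a i)) ^ 2 * t) * intervalHeatKernel (a i) t (x i) (y i) /
        ((1 / √(a i) * cos (π * x i / (2 * a i))) *
          (1 / √(a i) * cos (π * y i / (2 * a i))))) := by
    rw [Finset.prod_div_distrib, Finset.prod_mul_distrib, Finset.prod_mul_distrib,
      Finset.sum_mul, exp_sum, boxEigenfunction, boxEigenfunction]
  have hconst : ∀ (b : ℝ) (g : Fin n → ℝ), b ^ n * ∏ i, g i = ∏ i, b * g i := by
    intro b g
    rw [Finset.prod_mul_distrib, Finset.prod_const, Finset.card_univ, Fintype.card_fin]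
  rw [hratio, hconst, hconst]
  constructor
  · refine (le_abs_self _).trans ?_
    rw [Finset.abs_prod]
    exact Finset.prod_le_prod (fun i _ => abs_nonneg _)
      fun i _ => abs_interval_ratio_le ht (hx i) (hy i)
  · intro hat
    refine Finset.prod_le_prod (fun i _ => ?_) fun i _ => ?_
    · have h1 : a i / √t ≤ 1 := by
        rw [div_le_one (sqrt_pos.2 ht)]
        exact le_sqrt_of_sq_le (hat i)
      have h0 : 0 ≤ a i / √t := div_nonneg (ha i).le (sqrt_nonneg t)
      have := pow_le_one₀ h0 h1 (n := 3)
      linarith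
    · have h0 : 0 ≤ (a i / √t) ^ 3 := pow_nonneg (div_nonneg (ha i).le (sqrt_nonneg t)) 3
      have := half_le_interval_ratio (hat i) (hx i) (hy i)
      linarith
end
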